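/- Let 0 ≤ q ≤ 1 with 4q(1−q) ≤ 1/2. Then Q^(1)(T^BB84_q) = H(1/2 − 2q(1−q)) − H(2q(1−q)). -/

import Mathlib

open scoped Matrix Kronecker ComplexOrder

/-- A finite family of Kraus operators from input space `A` to output space `B`. -/
structure KrausFamily (A B : Type) [Fintype A] [DecidableEq A] [Fintype B] [DecidableEq B] :
    Type 1 where
  ι : Type
  [fι : Fintype ι]
  [dι : DecidableEq ι]
  K : ι → Matrix B A ℂ

attribute [instance] KrausFamily.fι KrausFamily.dι

variable {A B : Type} [Fintype A] [DecidableEq A] [Fintype B] [DecidableEq B]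

/-- The trace-preservation condition `Σ Kᵢ† Kᵢ = 1` making a Kraus family a quantum channel. -/
def KrausFamily.IsChannel (N : KrausFamily A B) : Prop :=
  ∑ i, (N.K i)ᴴ * N.K i = 1

/-- The action of a channel: `N(ρ) = Σ Kᵢ ρ Kᵢ†`. -/
noncomputable def KrausFamily.apply (N : KrausFamily A B) (ρ : Matrix A A ℂ) : Matrix B B ℂ :=
  ∑ i, N.K i * ρ * (N.K i)ᴴ

/-- The complementary channel: `N̂(ρ)ᵢⱼ = Tr (Kᵢ ρ Kⱼ†)`. -/
noncomputable def KrausFamily.compl (N : KrausFamily A B) (ρ : Matrix A A ℂ) :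
    Matrix N.ι N.ι ℂ :=
  Matrix.of fun i j => (N.K i * ρ * (N.K j)ᴴ).trace

/-- Von Neumann entropy, base 2: `S(ρ) = −Σ λⱼ log₂ λⱼ` over the eigenvalues of `ρ`
(junk value `0` for non-Hermitian matrices). -/
noncomputable def vnEntropy {n : Type} [Fintype n] [DecidableEq n] (ρ : Matrix n n ℂ) : ℝ :=
  if h : ρ.IsHermitian then -∑ j, h.eigenvalues j * Real.logb 2 (h.eigenvalues j) else 0

/-- A density matrix: positive semidefinite with unit trace. -/
def IsDensity {n : Type} [Fintype n] (ρ : Matrix n n ℂ) : Prop :=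
  ρ.PosSemidef ∧ ρ.trace = 1

/-- Coherent information of `N` at input `φ`: `I^c(N,φ) = S(N(φ)) − S(N̂(φ))`. -/
noncomputable def cohInfo (N : KrausFamily A B) (φ : Matrix A A ℂ) : ℝ :=
  vnEntropy (N.apply φ) - vnEntropy (N.compl φ)

/-- One-shot quantum capacity: `Q^{(1)}(N) = sup_φ I^c(N,φ)` over density matrices `φ`. -/
noncomputable def Q1 (N : KrausFamily A B) : ℝ :=
  sSup {x | ∃ φ : Matrix A A ℂ, IsDensity φ ∧ x = cohInfo N φ}

/-- The `n`-th tensor power of a Kraus family, whose Kraus operators are all `n`-fold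
Kronecker products of Kraus operators of `N`. -/
noncomputable def KrausFamily.pow (N : KrausFamily A B) (n : ℕ) :
    KrausFamily (Fin n → A) (Fin n → B) where
  ι := Fin n → N.ι
  K f := Matrix.of fun b a => ∏ i, N.K (f i) (b i) (a i)

/-- Quantum capacity: `Q(N) = sup_{n ≥ 1} (1/n) Q^{(1)}(N^{⊗n})`. -/
noncomputable def Qcap (N : KrausFamily A B) : ℝ :=
  sSup {x | ∃ n : ℕ, 0 < n ∧ x = (1 / (n : ℝ)) * Q1 (N.pow n)}

/-- `N` is degradable if some channel `D` maps its output to its complementary output. -/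
def KrausFamily.IsDegradable (N : KrausFamily A B) : Prop :=
  ∃ D : KrausFamily B N.ι, D.IsChannel ∧ ∀ ρ : Matrix A A ℂ, D.apply (N.apply ρ) = N.compl ρ

/-- `N` is antidegradable if some channel `D` maps its complementary output to its output. -/
def KrausFamily.IsAntidegradable (N : KrausFamily A B) : Prop :=
  ∃ D : KrausFamily N.ι B, D.IsChannel ∧ ∀ ρ : Matrix A A ℂ, D.apply (N.compl ρ) = N.apply ρ

/-- Pauli `X`. -/
def PauliX : Matrix (Fin 2) (Fin 2) ℂ := !![0, 1; 1, 0]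

/-- Pauli `Y`. -/
def PauliY : Matrix (Fin 2) (Fin 2) ℂ := !![0, -Complex.I; Complex.I, 0]

/-- Pauli `Z`. -/
def PauliZ : Matrix (Fin 2) (Fin 2) ℂ := !![1, 0; 0, -1]

/-- The amplitude-damping Kraus operator `A₀ = [[1,0],[0,√(1−γ)]]`. -/
noncomputable def Aad0 (γ : ℝ) : Matrix (Fin 2) (Fin 2) ℂ :=
  !![1, 0; 0, ((Real.sqrt (1 - γ) : ℝ) : ℂ)]

/-- The amplitude-damping Kraus operator `A₁ = [[0,√γ],[0,0]]`. -/
noncomputable def Aad1 (γ : ℝ) : Matrix (Fin 2) (Fin 2) ℂ :=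
  !![0, ((Real.sqrt γ : ℝ) : ℂ); 0, 0]

/-- The amplitude damping channel `N^ad_γ`. -/
noncomputable def Nad (γ : ℝ) : KrausFamily (Fin 2) (Fin 2) where
  ι := Fin 2
  K := ![Aad0 γ, Aad1 γ]

/-- The flagged channel
`T^BB84_q(ρ) = ½ N^ad_{γ(q)}(ρ) ⊗ |0⟩⟨0| + ½ Y N^ad_{γ(q)}(YρY) Y ⊗ |1⟩⟨1|` with
`γ(q) = 4q(1−q)`, whose Kraus operators are `(1/√2) Aⱼ ⊗ |0⟩` and `(1/√2) Y Aⱼ Y ⊗ |1⟩`. -/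
noncomputable def TBB84 (q : ℝ) : KrausFamily (Fin 2) (Fin 2 × Fin 2) where
  ι := Fin 2 × Fin 2
  K x := Matrix.of fun bf a =>
    if bf.2 = x.1 then
      ((Real.sqrt 2)⁻¹ : ℂ) *
        (if x.1 = 0 then (![Aad0 (4 * q * (1 - q)), Aad1 (4 * q * (1 - q))] x.2) bf.1 a
          else (PauliY * (![Aad0 (4 * q * (1 - q)), Aad1 (4 * q * (1 - q))] x.2) * PauliY)
            bf.1 a)
    else 0

/-- Action of the Pauli channel
`ρ ↦ (1−q)²ρ + q(1−q) XρX + q² ZρZ + q(1−q) YρY` (the flag-traced `T^BB84_q`). -/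
noncomputable def pauliFlagTracedAction (q : ℝ) (ρ : Matrix (Fin 2) (Fin 2) ℂ) :
    Matrix (Fin 2) (Fin 2) ℂ :=
  (((1 - q) ^ 2 : ℝ) : ℂ) • ρ + ((q * (1 - q) : ℝ) : ℂ) • (PauliX * ρ * PauliX) +
    ((q ^ 2 : ℝ) : ℂ) • (PauliZ * ρ * PauliZ) +
    ((q * (1 - q) : ℝ) : ℂ) • (PauliY * ρ * PauliY)

/-- Action of the BB84 channel
`N^BB84_q(ρ) = (1−q)²ρ + q(1−q) XρX + q(1−q) ZρZ + q² YρY`. -/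
noncomputable def NBB84action (q : ℝ) (ρ : Matrix (Fin 2) (Fin 2) ℂ) :
    Matrix (Fin 2) (Fin 2) ℂ :=
  (((1 - q) ^ 2 : ℝ) : ℂ) • ρ + ((q * (1 - q) : ℝ) : ℂ) • (PauliX * ρ * PauliX) +
    ((q * (1 - q) : ℝ) : ℂ) • (PauliZ * ρ * PauliZ) +
    ((q ^ 2 : ℝ) : ℂ) • (PauliY * ρ * PauliY)

/-- Partial trace over a flag system carried as the second tensor factor. -/
noncomputable def trFlag {B : Type} [Fintype B] {m : ℕ}
    (M : Matrix (B × Fin m) (B × Fin m) ℂ) : Matrix B B ℂ :=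
  Matrix.of fun a b => ∑ i, M (a, i) (b, i)

/-- Binary entropy `H(x) = −x log₂ x − (1−x) log₂ (1−x)`. -/
noncomputable def binEnt (x : ℝ) : ℝ :=
  -x * Real.logb 2 x - (1 - x) * Real.logb 2 (1 - x)



open Filter Topology in
lemma tendsto_add_mul_log_add_sub (a : ℝ) :
    Tendsto (fun s : ℝ => (s + a) * Real.log (s + a) - (s + a) * Real.log s) atTop (𝓝 a) := by
  have h1 := Real.tendsto_mul_log_one_add_div_atTop a
  have h2 : Tendsto (fun s : ℝ => a * Real.log (1 + a / s)) atTop (𝓝 0) := by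
    have h : Tendsto (fun s : ℝ => 1 + a / s) atTop (𝓝 (1 + 0)) :=
      tendsto_const_nhds.add (tendsto_const_nhds.div_atTop tendsto_id)
    rw [add_zero] at h
    simpa using (h.log one_ne_zero).const_mul a
  have h3 := h1.add h2
  rw [add_zero] at h3
  refine h3.congr' ?_
  filter_upwards [eventually_gt_atTop (0 : ℝ), eventually_gt_atTop (-a)] with s hs hsa
  have h4 : 1 + a / s = (s + a) / s := by field_simp
  rw [h4, Real.log_div (by linarith) hs.ne']
  ring

open Filter Topology in
/-- Pointwise comparison of the polynomials `∏ (s + aᵢ)` and `∏ (s + bᵢ)` compares entropies. -/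
lemma sum_negMulLog_le_of_prod_le {ι : Type*} [Fintype ι] {a b : ι → ℝ}
    (ha : ∀ i, 0 ≤ a i) (hb : ∀ i, 0 ≤ b i) (hsum : ∑ i, a i = ∑ i, b i)
    (hprod : ∀ s : ℝ, 0 < s → ∏ i, (s + a i) ≤ ∏ i, (s + b i)) :
    ∑ i, Real.negMulLog (a i) ≤ ∑ i, Real.negMulLog (b i) := by
  set G : ℝ → ℝ := fun s =>
    ∑ i, ((s + a i) * Real.log (s + a i)) - ∑ i, ((s + b i) * Real.log (s + b i)) with hG
  have hcont : Continuous G := by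
    have h (c : ℝ) : Continuous fun s : ℝ => (s + c) * Real.log (s + c) :=
      Real.continuous_mul_log.comp (continuous_id.add continuous_const)
    exact (continuous_finsetSum _ fun i _ => h (a i)).sub
      (continuous_finsetSum _ fun i _ => h (b i))
  have hder (s : ℝ) (hs : 0 < s) : HasDerivAt G
      (∑ i, (Real.log (s + a i) + 1) - ∑ i, (Real.log (s + b i) + 1)) s := by
    have h (c : ℝ) (hc : 0 ≤ c) :
        HasDerivAt (fun s : ℝ => (s + c) * Real.log (s + c)) (Real.log (s + c) + 1) s := by
      have := (Real.hasDerivAt_mul_log (x := s + c) (by positivity)).comp_add_const s c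
      exact this
    exact (HasDerivAt.fun_sum fun i _ => h (a i) (ha i)).sub
      (HasDerivAt.fun_sum fun i _ => h (b i) (hb i))
  have hanti : AntitoneOn G (Set.Ici 0) := by
    refine antitoneOn_of_deriv_nonpos (convex_Ici 0) hcont.continuousOn ?_ ?_
    · intro s hs
      rw [interior_Ici] at hs
      exact (hder s hs).differentiableAt.differentiableWithinAt
    · intro s hs
      rw [interior_Ici] at hs
      have hs : 0 < s := hs
      rw [(hder s hs).deriv, Finset.sum_add_distrib, Finset.sum_add_distrib,
        ← Real.log_prod (fun i _ => (add_pos_of_pos_of_nonneg hs (ha i)).ne'),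
        ← Real.log_prod (fun i _ => (add_pos_of_pos_of_nonneg hs (hb i)).ne')]
      have := Real.log_le_log
        (Finset.prod_pos fun i _ => add_pos_of_pos_of_nonneg hs (ha i)) (hprod s hs)
      linarith
  have hlim : Tendsto G atTop (𝓝 0) := by
    have h := (tendsto_finsetSum Finset.univ fun i _ => tendsto_add_mul_log_add_sub (a i)).sub
      (tendsto_finsetSum Finset.univ fun i _ => tendsto_add_mul_log_add_sub (b i))
    rw [hsum, sub_self] at h
    refine h.congr fun s => ?_
    simp only [hG, Finset.sum_sub_distrib, ← Finset.sum_mul, Finset.sum_add_distrib, hsum]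
    ring
  have h0 : 0 ≤ G 0 := by
    refine le_of_tendsto hlim ?_
    filter_upwards [eventually_ge_atTop (0 : ℝ)] with s hs
    exact hanti (Set.mem_Ici.2 le_rfl) hs hs
  simp only [hG, zero_add] at h0
  simp only [Real.negMulLog, neg_mul, Finset.sum_neg_distrib]
  linarith

lemma prod_add_eigenvalues {n : Type*} [Fintype n] [DecidableEq n] {M : Matrix n n ℂ}
    (h : M.IsHermitian) (s : ℝ) :
    ((∏ j, (s + h.eigenvalues j) : ℝ) : ℂ) = (Matrix.scalar n (s : ℂ) + M).det := by
  have h1 := congrArg (Polynomial.eval (-(s : ℂ))) h.charpoly_eq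
  rw [Matrix.eval_charpoly, Polynomial.eval_prod] at h1
  have h2 : Matrix.scalar n (s : ℂ) + M = -(Matrix.scalar n (-(s : ℂ)) - M) := by
    rw [map_neg]; abel
  rw [h2, Matrix.det_neg, h1, Fintype.card, ← Finset.prod_const, ← Finset.prod_mul_distrib]
  push_cast
  refine Finset.prod_congr rfl fun j _ => ?_
  simp
  ring

lemma mul_le_mul_of_pairwise {x x' y y' x₀ x₀' y₀ y₀' z w : ℝ} (hx' : 0 ≤ x') (hy : 0 < y)
    (hy' : 0 < y') (hx₀ : 0 ≤ x₀) (hy₀ : 0 < y₀) (hy₀' : 0 < y₀')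
    (h : x * y₀ ≤ y * x₀) (h' : x' * y₀' ≤ y' * x₀')
    (h₀ : x₀ * x₀' * z ^ 2 ≤ y₀ * y₀' * w ^ 2) :
    x * x' * z ^ 2 ≤ y * y' * w ^ 2 := by
  refine le_of_mul_le_mul_right ?_ (mul_pos hy₀ hy₀')
  calc x * x' * z ^ 2 * (y₀ * y₀') = (x * y₀) * (x' * y₀') * z ^ 2 := by ring
    _ ≤ (y * x₀) * (y' * x₀') * z ^ 2 :=
        mul_le_mul_of_nonneg_right
          (mul_le_mul h h' (mul_nonneg hx' hy₀'.le) (mul_nonneg hy.le hx₀)) (sq_nonneg z)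
    _ = y * y' * (x₀ * x₀' * z ^ 2) := by ring
    _ ≤ y * y' * (y₀ * y₀' * w ^ 2) := mul_le_mul_of_nonneg_left h₀ (mul_pos hy hy').le
    _ = y * y' * w ^ 2 * (y₀ * y₀') := by ring

lemma damping_ratio_le {γ x t P : ℝ} (hγ0 : 0 ≤ γ) (hγ : γ ≤ 1 / 2) (ht0 : 0 ≤ t)
    (hP : 0 ≤ P) :
    (P + (1 - γ) * (x * (1 - (1 - γ) * x) - t) / 4) * (P + γ * (x * (1 - γ * x)) / 4) ≤
      (P + γ * (x * (1 - γ * x) - t) / 4) * (P + (1 - γ) * (x * (1 - (1 - γ) * x)) / 4) := by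
  have h1 : 0 ≤ P * ((1 - 2 * γ) * t) := mul_nonneg hP (mul_nonneg (by linarith) ht0)
  have h2 : 0 ≤ γ * (1 - γ) * t * (x ^ 2 * (1 - 2 * γ)) :=
    mul_nonneg (mul_nonneg (mul_nonneg hγ0 (by linarith)) ht0)
      (mul_nonneg (sq_nonneg x) (by linarith))
  nlinarith only [h1, h2]

lemma sq_sub_mul_sq_le {γ g m α β : ℝ} (hα : 0 ≤ γ * α) (h : γ * α ≤ g * β) (hm : 0 ≤ m) :
    (α ^ 2 - g ^ 2 * m) * β ^ 2 ≤ (β ^ 2 - γ ^ 2 * m) * α ^ 2 := by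
  have := mul_le_mul_of_nonneg_left (pow_le_pow_left₀ hα h 2) hm
  linarith

lemma diagonal_damping_prod_le {γ p s : ℝ} (hγ0 : 0 ≤ γ) (hγ : γ ≤ 1 / 2) (hp0 : 0 ≤ p)
    (hp1 : p ≤ 1) (hs : 0 < s) :
    (s ^ 2 + s / 2 + (1 - γ) * (p * (1 - (1 - γ) * p)) / 4) *
        (s ^ 2 + s / 2 + (1 - γ) * ((1 - p) * (1 - (1 - γ) * (1 - p))) / 4) *
        ((s + γ / 4) * (s + (1 - γ / 2) / 2)) ^ 2 ≤
      (s ^ 2 + s / 2 + γ * (p * (1 - γ * p)) / 4) *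
        (s ^ 2 + s / 2 + γ * ((1 - p) * (1 - γ * (1 - p))) / 4) *
        ((s + (1 - γ) / 4) * (s + (1 - (1 - γ) / 2) / 2)) ^ 2 := by
  have hm : 0 ≤ (1 / 2 - p) ^ 2 / 4 := by positivity
  have hg : 0 ≤ 1 - γ := by linarith
  have hp1' : 0 ≤ 1 - p := by linarith
  have key1 := sq_sub_mul_sq_le (γ := γ) (g := 1 - γ) (α := s + (1 - γ) / 4) (β := s + γ / 4)
    (by positivity) (by nlinarith only [hγ, hs]) hm
  have key2 := sq_sub_mul_sq_le (γ := γ) (g := 1 - γ) (α := s + 1 / 2 - (1 - γ) / 4)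
    (β := s + 1 / 2 - γ / 4) (mul_nonneg hγ0 (by linarith)) (by nlinarith only [hγ, hs]) hm
  have pos1 : 0 ≤ (s + 1 / 2 - (1 - γ) / 4) ^ 2 - (1 - γ) ^ 2 * ((1 / 2 - p) ^ 2 / 4) := by
    have h1 : 0 ≤ s + 1 / 2 - (1 - γ) * p / 2 := by nlinarith only [hs, mul_nonneg hγ0 hp0, hp1]
    have h2 : 0 ≤ s + 1 / 2 - (1 - γ) * (1 - p) / 2 := by
      nlinarith only [hs, mul_nonneg hγ0 hp1', hp0]
    have := mul_nonneg h1 h2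
    linarith
  have pos2 : 0 ≤ (s + γ / 4) ^ 2 - γ ^ 2 * ((1 / 2 - p) ^ 2 / 4) := by
    have : 0 ≤ (s + γ * p / 2) * (s + γ * (1 - p) / 2) := by positivity
    linarith
  have key := mul_le_mul key1 key2 (mul_nonneg pos1 (sq_nonneg _))
    (mul_nonneg pos2 (sq_nonneg _))
  linarith [key]

/-- The pointwise inequality behind concavity of the coherent information of amplitude damping,
symmetrized under `p ↦ 1 - p`. -/
lemma symmetrized_damping_prod_le {γ p t s : ℝ} (hγ0 : 0 ≤ γ) (hγ : γ ≤ 1 / 2) (hp0 : 0 ≤ p)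
    (hp1 : p ≤ 1) (ht0 : 0 ≤ t) (ht : t ≤ p * (1 - p)) (hs : 0 < s) :
    (s ^ 2 + s / 2 + (1 - γ) * (p * (1 - (1 - γ) * p) - t) / 4) *
        (s ^ 2 + s / 2 + (1 - γ) * ((1 - p) * (1 - (1 - γ) * (1 - p)) - t) / 4) *
        ((s + γ / 4) * (s + (1 - γ / 2) / 2)) ^ 2 ≤
      (s ^ 2 + s / 2 + γ * (p * (1 - γ * p) - t) / 4) *
        (s ^ 2 + s / 2 + γ * ((1 - p) * (1 - γ * (1 - p)) - t) / 4) *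
        ((s + (1 - γ) / 4) * (s + (1 - (1 - γ) / 2) / 2)) ^ 2 := by
  have pos (g x t : ℝ) (hg0 : 0 ≤ g) (hg1 : g ≤ 1) (hxt : t ≤ x * (1 - x)) :
      0 < s ^ 2 + s / 2 + g * (x * (1 - g * x) - t) / 4 := by
    have : 0 ≤ x * (1 - g * x) - t := by
      have : 0 ≤ x ^ 2 * (1 - g) := mul_nonneg (sq_nonneg x) (by linarith)
      linarith
    positivity
  have hP : 0 ≤ s ^ 2 + s / 2 := by positivity
  have hg : 0 ≤ 1 - γ := by linarith
  have hp : 0 ≤ p * (1 - p) := ht0.trans ht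
  have ht' : t ≤ (1 - p) * (1 - (1 - p)) := by linarith
  have hp' : 0 ≤ (1 - p) * (1 - (1 - p)) := by linarith
  have h0 := pos (1 - γ) p 0 hg (by linarith) hp
  have h1 := pos γ p 0 hγ0 (by linarith) hp
  have h2 := pos γ (1 - p) 0 hγ0 (by linarith) hp'
  rw [sub_zero] at h0 h1 h2
  exact mul_le_mul_of_pairwise (pos (1 - γ) (1 - p) t hg (by linarith) ht').le
    (pos γ p t hγ0 (by linarith) ht) (pos γ (1 - p) t hγ0 (by linarith) ht') h0.le h1 h2
    (damping_ratio_le hγ0 hγ ht0 hP) (damping_ratio_le hγ0 hγ ht0 hP)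
    (diagonal_damping_prod_le hγ0 hγ hp0 hp1 hs)

lemma KrausFamily.posSemidef_apply (N : KrausFamily A B) {ρ : Matrix A A ℂ}
    (h : ρ.PosSemidef) : (N.apply ρ).PosSemidef :=
  Matrix.posSemidef_sum _ fun i _ => h.mul_mul_conjTranspose_same (N.K i)

lemma KrausFamily.posSemidef_compl (N : KrausFamily A B) {ρ : Matrix A A ℂ}
    (h : ρ.PosSemidef) : (N.compl ρ).PosSemidef := by
  have : N.compl ρ = ∑ b, (Matrix.of fun i a => N.K i b a) * ρ *
      (Matrix.of fun i a => N.K i b a)ᴴ := by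
    ext i j
    simp [KrausFamily.compl, Matrix.sum_apply, Matrix.trace, Matrix.mul_apply]
  rw [this]
  exact Matrix.posSemidef_sum _ fun b _ => h.mul_mul_conjTranspose_same _

lemma vnEntropy_eq_sum_negMulLog {n : Type} [Fintype n] [DecidableEq n] {M : Matrix n n ℂ}
    (h : M.IsHermitian) :
    vnEntropy M = (∑ j, Real.negMulLog (h.eigenvalues j)) / Real.log 2 := by
  rw [vnEntropy, dif_pos h, Finset.sum_div, ← Finset.sum_neg_distrib]
  refine Finset.sum_congr rfl fun j _ => ?_
  rw [Real.negMulLog, Real.logb]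
  ring

lemma det_scalar_add_blockDiagonal (s : ℂ) (M : Fin 2 → Matrix (Fin 2) (Fin 2) ℂ) :
    (Matrix.scalar (Fin 2 × Fin 2) s + Matrix.blockDiagonal M).det =
      ((s + M 0 0 0) * (s + M 0 1 1) - M 0 0 1 * M 0 1 0) *
        ((s + M 1 0 0) * (s + M 1 1 1) - M 1 0 1 * M 1 1 0) := by
  have h : Matrix.scalar (Fin 2 × Fin 2) s + Matrix.blockDiagonal M =
      Matrix.blockDiagonal fun k => Matrix.scalar (Fin 2) s + M k := by
    have : Matrix.scalar (Fin 2 × Fin 2) s =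
        Matrix.blockDiagonal fun _ : Fin 2 => Matrix.scalar (Fin 2) s := by
      simp [Matrix.scalar_apply, Matrix.blockDiagonal_diagonal]
    rw [this, ← Matrix.blockDiagonal_add]
    rfl
  rw [h, Matrix.det_blockDiagonal]
  simp [Fin.prod_univ_two, Matrix.det_fin_two]

lemma trace_submatrix_equiv {m n : Type*} [Fintype m] [Fintype n] (e : m ≃ n)
    (M : Matrix n n ℂ) : (M.submatrix e e).trace = M.trace :=
  e.sum_comp fun i => M i i

lemma det_scalar_add_submatrix_equiv {m n : Type*} [Fintype m] [Fintype n] [DecidableEq m]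
    [DecidableEq n] (e : m ≃ n) (s : ℂ) (M : Matrix n n ℂ) :
    (Matrix.scalar m s + M.submatrix e e).det = (Matrix.scalar n s + M).det := by
  rw [← Matrix.det_submatrix_equiv_self e (Matrix.scalar n s + M), Matrix.submatrix_add]
  simp [Matrix.scalar_apply, Matrix.submatrix_diagonal_equiv, Function.comp_def]

lemma TBB84_apply (q : ℝ) (φ : Matrix (Fin 2) (Fin 2) ℂ) {a b r : ℂ}
    (ha : a = (Real.sqrt (1 - 4 * q * (1 - q)) : ℝ)) (hb : b = (Real.sqrt (4 * q * (1 - q)) : ℝ))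
    (hr : r = ((Real.sqrt 2 : ℝ) : ℂ)⁻¹) :
    (TBB84 q).apply φ = Matrix.blockDiagonal
      ![!![r ^ 2 * (φ 0 0 + b ^ 2 * φ 1 1), r ^ 2 * (a * φ 0 1);
          r ^ 2 * (a * φ 1 0), r ^ 2 * (a ^ 2 * φ 1 1)],
        !![r ^ 2 * (a ^ 2 * φ 0 0), r ^ 2 * (a * φ 0 1);
          r ^ 2 * (a * φ 1 0), r ^ 2 * (φ 1 1 + b ^ 2 * φ 0 0)]] := by
  have ha' : starRingEnd ℂ a = a := by rw [ha, Complex.conj_ofReal]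
  have hb' : starRingEnd ℂ b = b := by rw [hb, Complex.conj_ofReal]
  have hr' : starRingEnd ℂ r = r := by rw [hr, map_inv₀, Complex.conj_ofReal]
  have h : (TBB84 q).apply φ =
    ∑ i : Fin 2 × Fin 2, (TBB84 q).K i * φ * ((TBB84 q).K i)ᴴ := rfl
  rw [h]
  ext ⟨i, k⟩ ⟨j, l⟩
  fin_cases i <;> fin_cases k <;> fin_cases j <;> fin_cases l <;>
  simp [TBB84, Matrix.sum_apply, Fintype.sum_prod_type, Matrix.mul_apply, Aad0, Aad1, PauliY,
    Matrix.blockDiagonal_apply, ← ha, ← hb, ← hr, ha', hb', hr'] <;>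
  ring_nf <;> simp only [Complex.I_sq, Complex.I_pow_four] <;> ring

lemma TBB84_compl (q : ℝ) (φ : Matrix (Fin 2) (Fin 2) ℂ) {a b r : ℂ}
    (ha : a = (Real.sqrt (1 - 4 * q * (1 - q)) : ℝ)) (hb : b = (Real.sqrt (4 * q * (1 - q)) : ℝ))
    (hr : r = ((Real.sqrt 2 : ℝ) : ℂ)⁻¹) :
    (TBB84 q).compl φ = (Matrix.blockDiagonal
      ![!![r ^ 2 * (φ 0 0 + a ^ 2 * φ 1 1), r ^ 2 * (b * φ 0 1);
          r ^ 2 * (b * φ 1 0), r ^ 2 * (b ^ 2 * φ 1 1)],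
        !![r ^ 2 * (a ^ 2 * φ 0 0 + φ 1 1), -(r ^ 2 * (b * φ 1 0));
          -(r ^ 2 * (b * φ 0 1)), r ^ 2 * (b ^ 2 * φ 0 0)]]).submatrix
        (Equiv.prodComm (Fin 2) (Fin 2)) (Equiv.prodComm (Fin 2) (Fin 2)) := by
  have ha' : starRingEnd ℂ a = a := by rw [ha, Complex.conj_ofReal]
  have hb' : starRingEnd ℂ b = b := by rw [hb, Complex.conj_ofReal]
  have hr' : starRingEnd ℂ r = r := by rw [hr, map_inv₀, Complex.conj_ofReal]
  ext ⟨k, i⟩ ⟨l, j⟩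
  have h (x y : Fin 2 × Fin 2) : (TBB84 q).compl φ x y =
    ((TBB84 q).K x * φ * ((TBB84 q).K y)ᴴ).trace := rfl
  refine (h _ _).trans ?_
  fin_cases i <;> fin_cases k <;> fin_cases j <;> fin_cases l <;>
  simp [TBB84, Matrix.trace, Fintype.sum_prod_type, Matrix.mul_apply,
    Aad0, Aad1, PauliY, Matrix.blockDiagonal_apply, ← ha, ← hb, ← hr, ha', hb', hr'] <;>
  ring_nf <;> simp only [Complex.I_sq, Complex.I_pow_four] <;> ring

lemma IsDensity.exists_params {φ : Matrix (Fin 2) (Fin 2) ℂ} (h : IsDensity φ) :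
    ∃ p t : ℝ, 0 ≤ p ∧ p ≤ 1 ∧ 0 ≤ t ∧ t ≤ p * (1 - p) ∧
      φ 0 0 = 1 - p ∧ φ 1 1 = p ∧ φ 0 1 * φ 1 0 = t := by
  obtain ⟨hpsd, htr⟩ := h
  have h0 := hpsd.diag_nonneg (i := 0)
  have h1 := hpsd.diag_nonneg (i := 1)
  have hdet := hpsd.det_nonneg
  have hoff : φ 0 1 * φ 1 0 = (Complex.normSq (φ 0 1) : ℝ) := by
    rw [← hpsd.1.apply 1 0, ← Complex.mul_conj]
    rfl
  have h11 : φ 1 1 = ((φ 1 1).re : ℝ) := Complex.eq_re_of_ofReal_le h1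
  have h00 : φ 0 0 = 1 - ((φ 1 1).re : ℝ) := by
    rw [← h11, ← htr, Matrix.trace_fin_two]; ring
  refine ⟨(φ 1 1).re, Complex.normSq (φ 0 1), (Complex.nonneg_iff.1 h1).1, ?_,
    Complex.normSq_nonneg _, ?_, h00, h11, hoff⟩
  · rw [h00] at h0
    have : (0 : ℂ) ≤ ((1 - (φ 1 1).re : ℝ) : ℂ) := by push_cast; exact h0
    linarith [Complex.zero_le_real.1 this]
  · rw [Matrix.det_fin_two, hoff, h00, h11] at hdet
    have : (0 : ℂ) ≤ (((1 - (φ 1 1).re) * (φ 1 1).re - Complex.normSq (φ 0 1) : ℝ) : ℂ) := by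
      push_cast; exact hdet
    linarith [Complex.zero_le_real.1 this]

/-- The spectra of the output and of the complementary output of `TBB84 q`, described by the
polynomials `∏ (s + λᵢ)`. -/
lemma TBB84_exists_spectra {q γ p t : ℝ} {φ : Matrix (Fin 2) (Fin 2) ℂ}
    (hγq : γ = 4 * q * (1 - q)) (hγ0 : 0 ≤ γ) (hγ1 : γ ≤ 1) (hφ : φ.PosSemidef)
    (h00 : φ 0 0 = 1 - p) (h11 : φ 1 1 = p) (hoff : φ 0 1 * φ 1 0 = t) :
    ∃ e f : Fin 2 × Fin 2 → ℝ, (∀ i, 0 ≤ e i) ∧ (∀ i, 0 ≤ f i) ∧ ∑ i, e i = 1 ∧ ∑ i, f i = 1 ∧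
      cohInfo (TBB84 q) φ =
        (∑ i, Real.negMulLog (e i) - ∑ i, Real.negMulLog (f i)) / Real.log 2 ∧
      (∀ s : ℝ, ∏ i, (s + e i) =
        (s ^ 2 + s / 2 + (1 - γ) * (p * (1 - (1 - γ) * p) - t) / 4) *
          (s ^ 2 + s / 2 + (1 - γ) * ((1 - p) * (1 - (1 - γ) * (1 - p)) - t) / 4)) ∧
      ∀ s : ℝ, ∏ i, (s + f i) =
        (s ^ 2 + s / 2 + γ * (p * (1 - γ * p) - t) / 4) *
          (s ^ 2 + s / 2 + γ * ((1 - p) * (1 - γ * (1 - p)) - t) / 4) := by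
  obtain ⟨a, ha⟩ : ∃ a : ℂ, a = (Real.sqrt (1 - 4 * q * (1 - q)) : ℝ) := ⟨_, rfl⟩
  obtain ⟨b, hb⟩ : ∃ b : ℂ, b = (Real.sqrt (4 * q * (1 - q)) : ℝ) := ⟨_, rfl⟩
  obtain ⟨r, hr⟩ : ∃ r : ℂ, r = ((Real.sqrt 2 : ℝ) : ℂ)⁻¹ := ⟨_, rfl⟩
  have ha2 : a ^ 2 = 1 - γ := by
    rw [ha, ← hγq, ← Complex.ofReal_pow, Real.sq_sqrt (by linarith)]; push_cast; rfl
  have hb2 : b ^ 2 = γ := by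
    rw [hb, ← hγq, ← Complex.ofReal_pow, Real.sq_sqrt hγ0]
  have hr2 : r ^ 2 = 1 / 2 := by
    rw [hr, inv_pow, ← Complex.ofReal_pow, Real.sq_sqrt (by norm_num)]; norm_num
  have hM := (TBB84 q).posSemidef_apply hφ
  have hC := (TBB84 q).posSemidef_compl hφ
  refine ⟨hM.1.eigenvalues, hC.1.eigenvalues, hM.eigenvalues_nonneg, hC.eigenvalues_nonneg,
    ?_, ?_, ?_, fun s => ?_, fun s => ?_⟩
  · have h := hM.1.trace_eq_sum_eigenvalues
    have htr : ((TBB84 q).apply φ).trace = 1 := by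
      rw [TBB84_apply q φ ha hb hr, Matrix.trace_blockDiagonal]
      simp only [Fin.sum_univ_two, Matrix.trace_fin_two, Matrix.of_apply, Matrix.cons_val',
        Matrix.cons_val_zero, Matrix.cons_val_one, Matrix.cons_val_fin_one, ha2, hb2, hr2, h00,
        h11]
      ring
    have h' : ((∑ i, hM.1.eigenvalues i : ℝ) : ℂ) = 1 := by
      push_cast
      exact h.symm.trans htr
    exact_mod_cast h'
  · have h := hC.1.trace_eq_sum_eigenvalues
    have htr : ((TBB84 q).compl φ).trace = 1 := by
      rw [TBB84_compl q φ ha hb hr]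
      refine (trace_submatrix_equiv (Equiv.prodComm (Fin 2) (Fin 2)) _).trans ?_
      rw [Matrix.trace_blockDiagonal]
      simp only [Fin.sum_univ_two, Matrix.trace_fin_two, Matrix.of_apply, Matrix.cons_val',
        Matrix.cons_val_zero, Matrix.cons_val_one, Matrix.cons_val_fin_one, ha2, hb2, hr2, h00,
        h11]
      ring
    have h' : ((∑ i, hC.1.eigenvalues i : ℝ) : ℂ) = 1 := by
      push_cast
      exact h.symm.trans htr
    exact_mod_cast h'
  · rw [cohInfo, vnEntropy_eq_sum_negMulLog hM.1, vnEntropy_eq_sum_negMulLog hC.1, ← sub_div]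
    rfl
  · have h := prod_add_eigenvalues hM.1 s
    have hdet : (Matrix.scalar (Fin 2 × Fin 2) (s : ℂ) + (TBB84 q).apply φ).det =
        (((s ^ 2 + s / 2 + (1 - γ) * (p * (1 - (1 - γ) * p) - t) / 4) *
          (s ^ 2 + s / 2 + (1 - γ) * ((1 - p) * (1 - (1 - γ) * (1 - p)) - t) / 4) : ℝ) : ℂ) := by
      rw [TBB84_apply q φ ha hb hr, det_scalar_add_blockDiagonal]
      simp only [Matrix.of_apply, Matrix.cons_val', Matrix.cons_val_zero, Matrix.cons_val_one,
        Matrix.cons_val_fin_one, ha2, hb2, hr2, h00, h11]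
      push_cast
      have e : (1 / 2 * (a * φ 0 1)) * (1 / 2 * (a * φ 1 0)) = (1 - γ) * t / 4 := by
        rw [← ha2, ← hoff]; ring
      rw [e]
      ring
    exact_mod_cast h.trans hdet
  · have h := prod_add_eigenvalues hC.1 s
    have hdet : (Matrix.scalar (TBB84 q).ι (s : ℂ) + (TBB84 q).compl φ).det =
        (((s ^ 2 + s / 2 + γ * (p * (1 - γ * p) - t) / 4) *
          (s ^ 2 + s / 2 + γ * ((1 - p) * (1 - γ * (1 - p)) - t) / 4) : ℝ) : ℂ) := by
      rw [TBB84_compl q φ ha hb hr]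
      refine (det_scalar_add_submatrix_equiv (Equiv.prodComm (Fin 2) (Fin 2)) _ _).trans ?_
      rw [det_scalar_add_blockDiagonal]
      simp only [Matrix.of_apply, Matrix.cons_val', Matrix.cons_val_zero, Matrix.cons_val_one,
        Matrix.cons_val_fin_one, ha2, hb2, hr2, h00, h11]
      push_cast
      have e : (1 / 2 * (b * φ 0 1)) * (1 / 2 * (b * φ 1 0)) = γ * t / 4 := by
        rw [← hb2, ← hoff]; ring
      have e' : -(1 / 2 * (b * φ 1 0)) * -(1 / 2 * (b * φ 0 1)) = γ * t / 4 := by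
        rw [← e]; ring
      rw [e, e']
      ring
    exact_mod_cast h.trans hdet

/-- The spectrum of `½ (diag (x, 1 - x) ⊕ diag (x, 1 - x))`. -/
noncomputable def halvedBernoulli (x : ℝ) (i : Fin 2 × Fin 2) : ℝ :=
  if i.1 = 0 then x / 2 else (1 - x) / 2

lemma halvedBernoulli_nonneg {x : ℝ} (hx0 : 0 ≤ x) (hx1 : x ≤ 1) (i : Fin 2 × Fin 2) :
    0 ≤ halvedBernoulli x i := by
  unfold halvedBernoulli
  split_ifs <;> linarith

lemma sum_halvedBernoulli (x : ℝ) : ∑ i, halvedBernoulli x i = 1 := by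
  simp [halvedBernoulli, Fintype.sum_prod_type]

lemma prod_add_halvedBernoulli (x s : ℝ) :
    ∏ i, (s + halvedBernoulli x i) = ((s + x / 2) * (s + (1 - x) / 2)) ^ 2 := by
  simp only [halvedBernoulli, Fintype.prod_prod_type, Fin.prod_univ_two, if_true, one_ne_zero,
    if_false]
  ring

lemma sum_negMulLog_halvedBernoulli (x : ℝ) :
    ∑ i, Real.negMulLog (halvedBernoulli x i) = (binEnt x + 1) * Real.log 2 := by
  have h2 : Real.log 2 ≠ 0 := (Real.log_pos one_lt_two).ne'
  have h (y : ℝ) : Real.negMulLog (y / 2) = Real.negMulLog y / 2 + y * Real.log 2 / 2 := by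
    rw [div_eq_mul_inv, Real.negMulLog_mul, Real.negMulLog, Real.negMulLog, Real.log_inv]
    ring
  simp only [halvedBernoulli, Fintype.sum_prod_type, Fin.sum_univ_two, if_true, one_ne_zero,
    if_false, h]
  simp only [Real.negMulLog, binEnt, Real.logb]
  field_simp
  ring

lemma sub_sum_negMulLog_le {ι : Type*} [Fintype ι] {e f e' f' : ι → ℝ} (he : ∀ i, 0 ≤ e i)
    (hf : ∀ i, 0 ≤ f i) (he' : ∀ i, 0 ≤ e' i) (hf' : ∀ i, 0 ≤ f' i) (he1 : ∑ i, e i = 1)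
    (hf1 : ∑ i, f i = 1) (he1' : ∑ i, e' i = 1) (hf1' : ∑ i, f' i = 1)
    (hprod : ∀ s : ℝ, 0 < s →
      (∏ i, (s + e i)) * ∏ i, (s + f' i) ≤ (∏ i, (s + f i)) * ∏ i, (s + e' i)) :
    ∑ i, Real.negMulLog (e i) - ∑ i, Real.negMulLog (f i) ≤
      ∑ i, Real.negMulLog (e' i) - ∑ i, Real.negMulLog (f' i) := by
  have h := sum_negMulLog_le_of_prod_le (a := Sum.elim e f') (b := Sum.elim f e')
    (by rintro (i | i); exacts [he i, hf' i]) (by rintro (i | i); exacts [hf i, he' i])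
    (by simp [he1, hf1, he1', hf1']) (by simpa using hprod)
  simp only [Fintype.sum_sum_type, Sum.elim_inl, Sum.elim_inr] at h
  linarith

/-- For `0 ≤ q ≤ 1` with `4q(1−q) ≤ 1/2`,
`Q^{(1)}(T^BB84_q) = H(1/2 − 2q(1−q)) − H(2q(1−q))`. -/
theorem Q1_TBB84 (q : ℝ) (hq0 : 0 ≤ q) (hq1 : q ≤ 1)
    (hγ : 4 * q * (1 - q) ≤ 1 / 2) :
    Q1 (TBB84 q) = binEnt (1 / 2 - 2 * q * (1 - q)) - binEnt (2 * q * (1 - q)) := by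
  obtain ⟨γ, hγq⟩ : ∃ γ, γ = 4 * q * (1 - q) := ⟨_, rfl⟩
  have hγ0 : 0 ≤ γ := by
    rw [hγq]
    exact mul_nonneg (by linarith) (by linarith)
  rw [← hγq] at hγ
  have hlog : 0 < Real.log 2 := Real.log_pos one_lt_two
  have hx : 1 / 2 - 2 * q * (1 - q) = (1 - γ) / 2 := by rw [hγq]; ring
  have hy : 2 * q * (1 - q) = γ / 2 := by rw [hγq]; ring
  rw [hx, hy]
  have hval : binEnt ((1 - γ) / 2) - binEnt (γ / 2) =
      (∑ i, Real.negMulLog (halvedBernoulli ((1 - γ) / 2) i) -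
        ∑ i, Real.negMulLog (halvedBernoulli (γ / 2) i)) / Real.log 2 := by
    rw [sum_negMulLog_halvedBernoulli, sum_negMulLog_halvedBernoulli]
    field_simp
    ring
  have hX := halvedBernoulli_nonneg (x := (1 - γ) / 2) (by linarith) (by linarith)
  have hY := halvedBernoulli_nonneg (x := γ / 2) (by linarith) (by linarith)
  refine IsGreatest.csSup_eq ⟨⟨Matrix.diagonal fun _ => 1 / 2, ⟨?_, ?_⟩, ?_⟩, ?_⟩
  · exact Matrix.PosSemidef.diagonal fun _ => by positivity
  · simp
  · obtain ⟨e, f, he, hf, he1, hf1, hI, hE, hF⟩ := TBB84_exists_spectra (p := 1 / 2) (t := 0)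
      (φ := Matrix.diagonal fun _ => 1 / 2) hγq hγ0 (by linarith)
      (Matrix.PosSemidef.diagonal fun _ => by positivity)
      (by norm_num) (by norm_num) (by simp)
    rw [hI, hval]
    congr 1
    have hprod (s : ℝ) : (∏ i, (s + e i)) * ∏ i, (s + halvedBernoulli (γ / 2) i) =
        (∏ i, (s + f i)) * ∏ i, (s + halvedBernoulli ((1 - γ) / 2) i) := by
      rw [hE, hF, prod_add_halvedBernoulli, prod_add_halvedBernoulli]
      ring
    refine le_antisymm ?_ ?_
    · refine sub_sum_negMulLog_le hX hY he hf (sum_halvedBernoulli _) (sum_halvedBernoulli _)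
        he1 hf1 fun s _ => ?_
      linarith [hprod s]
    · exact sub_sum_negMulLog_le he hf hX hY he1 hf1 (sum_halvedBernoulli _)
        (sum_halvedBernoulli _) fun s _ => (hprod s).le
  · rintro _ ⟨φ, hφ, rfl⟩
    obtain ⟨p, t, hp0, hp1, ht0, ht, h00, h11, hoff⟩ := hφ.exists_params
    obtain ⟨e, f, he, hf, he1, hf1, hI, hE, hF⟩ :=
      TBB84_exists_spectra hγq hγ0 (by linarith) hφ.1 h00 h11 hoff
    rw [hI, hval]
    refine div_le_div_of_nonneg_right ?_ hlog.le
    refine sub_sum_negMulLog_le he hf hX hY he1 hf1 (sum_halvedBernoulli _)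
      (sum_halvedBernoulli _) fun s hs => ?_
    rw [hE, hF, prod_add_halvedBernoulli, prod_add_halvedBernoulli]
    have h := symmetrized_damping_prod_le hγ0 hγ hp0 hp1 ht0 ht hs
    have e1 : γ / 2 / 2 = γ / 4 := by ring
    have e2 : (1 - γ) / 2 / 2 = (1 - γ) / 4 := by ring
    rwa [e1, e2]
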